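/- Let a, b > 2 be integers with a odd and n = a + b − 1. Then the smallest normalized signless ∞-Laplacian eigenvalue of ET(n, a, b) is given by: μ_∞ = 1/a if b is odd and a > 2b; μ_∞ = 1/(2·min{a,b}) if b is odd, a ≤ 2b and b ≤ 2a; μ_∞ = 1/b if b is odd and b > 2a; μ_∞ = 1/max{2a, a+b} if b is even. -/

import Mathlib

/-- The weighted signless edge-vertex incidence matrix `W = B D⁻¹` of the bicyclic graph
`ET(n, a, b)` with `n = a + b - 1` vertices `v_1, …, v_n` and `n + 1 = a + b` edges
`e_1, …, e_{n+1}`, where `e_k` joins `v_k` and `v_{k+1}` for `k = 1, …, a-1`; `e_a` joins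
`v_a` and `v_1`; `e_k` joins `v_{k-1}` and `v_k` for `k = a+1, …, n`; and `e_{n+1}` joins
`v_n` and `v_a`. Rows are indexed by edges (edge `e_k` corresponds to index `k - 1` in
`Fin (a + b)`), columns by vertices (vertex `v_j` corresponds to index `j - 1` in
`Fin (a + b - 1)`); the entry in row `e_k`, column `v_j` is `1 / deg v_j` if `v_j` is
incident to `e_k`, and `0` otherwise (the degree of `v_a` is `4`, all other degrees are `2`). -/
noncomputable def ETW (a b : ℕ) : Matrix (Fin (a + b)) (Fin (a + b - 1)) ℝ :=
  fun k j =>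
    let n := a + b - 1
    let K := (k : ℕ) + 1
    let J := (j : ℕ) + 1
    let u : ℕ := if K ≤ a - 1 then K else if K = a then a else if K ≤ n then K - 1 else n
    let v : ℕ := if K ≤ a - 1 then K + 1 else if K = a then 1 else if K ≤ n then K else a
    if J = u ∨ J = v then (if J = a then (4 : ℝ)⁻¹ else (2 : ℝ)⁻¹) else 0

/-- The coordinate of `D⁻¹ X` at the vertex with (zero-based) index `i`. -/
noncomputable def weightedCoord (a b : ℕ) (X : Fin (a + b - 1) → ℝ) (i : ℕ) : ℝ :=
  if h : i < a + b - 1 then (if i + 1 = a then (4 : ℝ)⁻¹ else (2 : ℝ)⁻¹) * X ⟨i, h⟩ else 0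

/-- The closed walk around the first cycle, starting at the common vertex. -/
def walkA (a i : ℕ) : ℕ := if i = 0 then a - 1 else i - 1

/-- The closed walk around the second cycle, starting at the common vertex. -/
def walkB (a b i : ℕ) : ℕ := if i = b then a - 1 else a - 1 + i

lemma mulVec_eq_add_of_row {a b : ℕ} (X : Fin (a + b - 1) → ℝ) (k : Fin (a + b)) (u v : ℕ)
    (hu : u < a + b - 1) (hv : v < a + b - 1) (huv : u ≠ v)
    (h : ∀ j : Fin (a + b - 1), ETW a b k j =
      if (j : ℕ) = u ∨ (j : ℕ) = v then
        (if (j : ℕ) + 1 = a then (4 : ℝ)⁻¹ else (2 : ℝ)⁻¹) else 0) :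
    (ETW a b).mulVec X k = weightedCoord a b X u + weightedCoord a b X v := by
  rw [Matrix.mulVec, dotProduct, Finset.sum_eq_add (⟨u, hu⟩ : Fin (a + b - 1)) ⟨v, hv⟩]
  · simp [h, weightedCoord, hu, hv]
  · simpa using huv
  · intro c _ hc
    have h1 : (c : ℕ) ≠ u := fun e => hc.1 (Fin.ext e)
    have h2 : (c : ℕ) ≠ v := fun e => hc.2 (Fin.ext e)
    simp [h, h1, h2]
  · simp
  · simp

lemma mulVec_first_edge {a b : ℕ} (ha : 2 < a) (hb : 2 < b) (X : Fin (a + b - 1) → ℝ)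
    {i : ℕ} (hi : i < a) (hk : walkA a i < a + b) :
    (ETW a b).mulVec X ⟨walkA a i, hk⟩ =
      weightedCoord a b X (walkA a i) + weightedCoord a b X (walkA a (i + 1)) := by
  have hu : i = 0 ∧ walkA a i = a - 1 ∨ 0 < i ∧ walkA a i = i - 1 := by
    unfold walkA; split_ifs <;> omega
  have hv : walkA a (i + 1) = i := by simp [walkA]
  rw [hv]
  generalize walkA a i = u at *
  apply mulVec_eq_add_of_row
  · omega
  · omega
  · omega
  · intro j
    have := j.2
    simp only [ETW]
    congr 1
    apply propext
    split_ifs <;> omega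

lemma mulVec_second_edge {a b : ℕ} (ha : 2 < a) (hb : 2 < b) (X : Fin (a + b - 1) → ℝ)
    {i : ℕ} (hi : i < b) (hk : a + i < a + b) :
    (ETW a b).mulVec X ⟨a + i, hk⟩ =
      weightedCoord a b X (walkB a b i) + weightedCoord a b X (walkB a b (i + 1)) := by
  apply mulVec_eq_add_of_row
  · unfold walkB; split_ifs <;> omega
  · unfold walkB; split_ifs <;> omega
  · unfold walkB; split_ifs <;> omega
  · intro j
    have := j.2
    simp only [ETW]
    congr 1
    unfold walkB
    apply propext
    split_ifs <;> omega

lemma abs_sub_neg_one_pow_mul_le {n : ℕ} {h : ℕ → ℝ} {m : ℝ}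
    (hm : ∀ i < n, |h i + h (i + 1)| ≤ m) (k : ℕ) (hk : k ≤ n) :
    |h k - (-1) ^ k * h 0| ≤ k * m := by
  induction k with
  | zero => simp
  | succ k ih =>
    have h1 := ih (by omega)
    have h2 := hm k (by omega)
    have e : h (k + 1) - (-1) ^ (k + 1) * h 0 =
        (h k + h (k + 1)) - (h k - (-1) ^ k * h 0) := by ring
    rw [e]
    push_cast
    linarith [abs_sub (h k + h (k + 1)) (h k - (-1) ^ k * h 0)]

lemma abs_sub_neg_one_pow_mul_le_reverse {n : ℕ} {h : ℕ → ℝ} {m : ℝ} (h0 : h n = h 0)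
    (hm : ∀ i < n, |h i + h (i + 1)| ≤ m) (k : ℕ) (hk : k ≤ n) :
    |h k - (-1) ^ (n - k) * h 0| ≤ ((n : ℝ) - k) * m := by
  have := abs_sub_neg_one_pow_mul_le (n := n) (h := fun i => h (n - i)) (m := m) ?_ (n - k)
    (by omega)
  · simpa [Nat.sub_sub_self hk, h0, Nat.cast_sub hk] using this
  · intro i hi
    have := hm (n - (i + 1)) (by omega)
    rw [show n - (i + 1) + 1 = n - i by omega, add_comm] at this
    exact this

lemma two_mul_abs_le_of_odd {n : ℕ} (hn : Odd n) {h : ℕ → ℝ} {m : ℝ} (h0 : h n = h 0)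
    (hm : ∀ i < n, |h i + h (i + 1)| ≤ m) (k : ℕ) (hk : k ≤ n) :
    2 * |h k| ≤ n * m := by
  have h1 := abs_sub_neg_one_pow_mul_le hm k hk
  have h2 := abs_sub_neg_one_pow_mul_le_reverse h0 hm k hk
  have e : ((-1 : ℝ)) ^ (n - k) = -(-1) ^ k := by
    rcases Nat.even_or_odd k with hk' | hk'
    · rw [(Nat.Odd.sub_even hk hn hk').neg_one_pow, hk'.neg_one_pow]
    · rw [(Nat.Odd.sub_odd hn hk').neg_one_pow, hk'.neg_one_pow]; norm_num
  rw [e] at h2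
  rw [abs_le] at h1 h2
  rcases abs_cases (h k) with ⟨hh, _⟩ | ⟨hh, _⟩ <;> rw [hh] <;> linarith [h1.1, h1.2, h2.1, h2.2]

lemma two_mul_abs_le {n : ℕ} {h : ℕ → ℝ} {m : ℝ} (h0 : h n = h 0)
    (hm : ∀ i < n, |h i + h (i + 1)| ≤ m) (k : ℕ) (hk : k ≤ n) :
    2 * |h k| ≤ 2 * |h 0| + n * m := by
  have h1 := abs_sub_neg_one_pow_mul_le hm k hk
  have h2 := abs_sub_neg_one_pow_mul_le_reverse h0 hm k hk
  have h3 := abs_sub_abs_le_abs_sub (h k) ((-1) ^ k * h 0)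
  have h4 := abs_sub_abs_le_abs_sub (h k) ((-1) ^ (n - k) * h 0)
  simp only [abs_mul, abs_pow, abs_neg, abs_one, one_pow, one_mul] at h3 h4
  linarith

lemma constraints_of_norm_eq_one {a b : ℕ} (ha : 2 < a) (hb : 2 < b) (haodd : Odd a)
    {X : Fin (a + b - 1) → ℝ} (hX : ‖X‖ = 1) {m : ℝ} (hm : ‖(ETW a b).mulVec X‖ = m) :
    ∃ c : ℝ, 0 ≤ c ∧ c ≤ 1 / 4 ∧ 2 * c ≤ a * m ∧ (Odd b → 2 * c ≤ b * m) ∧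
      (c = 1 / 4 ∨ 1 ≤ a * m ∨ (1 ≤ 2 * c + b * m ∧ (Odd b → 1 ≤ b * m))) := by
  have hA : ∀ i < a, |weightedCoord a b X (walkA a i) + weightedCoord a b X (walkA a (i + 1))|
      ≤ m := by
    intro i hi
    have hk : walkA a i < a + b := by unfold walkA; split_ifs <;> omega
    rw [← mulVec_first_edge ha hb X hi hk, ← hm]
    exact norm_le_pi_norm ((ETW a b).mulVec X) _
  have hB : ∀ i < b,
      |weightedCoord a b X (walkB a b i) + weightedCoord a b X (walkB a b (i + 1))| ≤ m := by
    intro i hi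
    rw [← mulVec_second_edge ha hb X hi (by omega), ← hm]
    exact norm_le_pi_norm ((ETW a b).mulVec X) _
  have hA0 : walkA a 0 = a - 1 := by simp [walkA]
  have hAa : walkA a a = a - 1 := by simp [walkA]
  have hB0 : walkB a b 0 = a - 1 := by simp [walkB]
  have hBb : walkB a b b = a - 1 := by simp [walkB]
  have hc : |weightedCoord a b X (a - 1)| = |X ⟨a - 1, by omega⟩| / 4 := by
    rw [weightedCoord, dif_pos (by omega), if_pos (by omega), abs_mul]
    norm_num
    ring
  have hXle : ∀ j, |X j| ≤ 1 := fun j => hX ▸ norm_le_pi_norm X j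
  obtain ⟨j, hj⟩ : ∃ j, |X j| = 1 := by
    by_contra hcon
    push Not at hcon
    have : ‖X‖ < 1 := (pi_norm_lt_iff one_pos).2 fun j => lt_of_le_of_ne (hXle j) (hcon j)
    linarith
  have oddA := two_mul_abs_le_of_odd (h := fun i => weightedCoord a b X (walkA a i)) haodd
    (by simp [hA0, hAa]) hA
  have oddB := fun hbodd => two_mul_abs_le_of_odd
    (h := fun i => weightedCoord a b X (walkB a b i)) (n := b) hbodd (by simp [hB0, hBb]) hB
  have evenB := two_mul_abs_le (h := fun i => weightedCoord a b X (walkB a b i)) (n := b)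
    (by simp [hB0, hBb]) hB
  simp only [hB0] at evenB
  refine ⟨|weightedCoord a b X (a - 1)|, abs_nonneg _, ?_, ?_, ?_, ?_⟩
  · rw [hc]
    linarith [hXle ⟨a - 1, by omega⟩]
  · simpa [hA0] using oddA 0 (by omega)
  · intro hbodd
    simpa [hB0] using oddB hbodd 0 (by omega)
  · obtain ⟨j, hjlt⟩ := j
    by_cases h1 : j = a - 1
    · subst h1
      left
      rw [hc, hj]
    have hval : |weightedCoord a b X j| = 1 / 2 := by
      rw [weightedCoord, dif_pos hjlt, if_neg (by omega), abs_mul, hj]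
      norm_num
    right
    by_cases h2 : j < a
    · left
      have := oddA (j + 1) (by omega)
      simp only [walkA, Nat.add_eq_zero_iff, one_ne_zero, and_false, if_false,
        Nat.add_sub_cancel] at this
      rw [hval] at this
      linarith
    · right
      have e : walkB a b (j + 1 - a) = j := by unfold walkB; split_ifs <;> omega
      have := evenB (j + 1 - a) (by omega)
      rw [e, hval] at this
      refine ⟨by linarith, fun hbodd => ?_⟩
      have := oddB hbodd (j + 1 - a) (by omega)
      rw [e, hval] at this
      linarith

lemma exists_norm_eq_one_of_labels {a b : ℕ} (ha : 2 < a) (hb : 2 < b) (haodd : Odd a)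
    {f g : ℕ → ℝ} {m : ℝ} (hfa : f a = -f 0) (hg0 : g 0 = f 0) (hgb : g b = (-1) ^ b * f 0)
    (hf : ∀ i < a, |f (i + 1) - f i| ≤ m) (hg : ∀ i < b, |g (i + 1) - g i| ≤ m)
    (hf' : ∀ i < a, |f i| ≤ 1 / 2) (hg' : ∀ i < b, |g i| ≤ 1 / 2) (hc : |f 0| ≤ 1 / 4)
    (hpeak : |f 0| = 1 / 4 ∨ (∃ i, 0 < i ∧ i < a ∧ |f i| = 1 / 2) ∨
      ∃ i, 0 < i ∧ i < b ∧ |g i| = 1 / 2) :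
    ∃ X : Fin (a + b - 1) → ℝ, ‖X‖ = 1 ∧ ‖(ETW a b).mulVec X‖ ≤ m := by
  set y : ℕ → ℝ := fun j => if j < a then (-1) ^ (j + 1) * f (j + 1)
    else (-1) ^ (j + 1 - a) * g (j + 1 - a) with hy
  set X : Fin (a + b - 1) → ℝ := fun j => (if (j : ℕ) + 1 = a then 4 else 2) * y j with hX
  have hm : 0 ≤ m := (abs_nonneg _).trans (hf 0 (by omega))
  have hyX : ∀ j < a + b - 1, weightedCoord a b X j = y j := by
    intro j hj
    rw [weightedCoord, dif_pos hj, hX]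
    dsimp only
    split_ifs <;> ring
  have hyA : ∀ i ≤ a, y (walkA a i) = (-1) ^ i * f i := by
    intro i hi
    simp only [hy, walkA]
    split_ifs with h1 h2 h3
    · subst h1
      rw [Nat.sub_add_cancel (by omega), hfa, haodd.neg_one_pow]; simp
    · omega
    · rw [Nat.sub_add_cancel (by omega)]
    · omega
  have hyB : ∀ i ≤ b, y (walkB a b i) = (-1) ^ i * g i := by
    intro i hi
    simp only [hy, walkB]
    split_ifs with h1 h2 h3
    · subst h1
      rw [Nat.sub_add_cancel (by omega), hfa, haodd.neg_one_pow, hgb, ← mul_assoc, ← mul_pow]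
      simp
    · omega
    · obtain rfl : i = 0 := by omega
      rw [Nat.add_zero, Nat.sub_add_cancel (by omega), hfa, haodd.neg_one_pow, hg0]; simp
    · rw [show a - 1 + i + 1 - a = i by omega]
  have hstep : ∀ (h : ℕ → ℝ) (i : ℕ), |(-1) ^ i * h i + (-1) ^ (i + 1) * h (i + 1)| =
      |h (i + 1) - h i| := by
    intro h i
    rw [show (-1) ^ i * h i + (-1) ^ (i + 1) * h (i + 1) =
      -((-1) ^ i * (h (i + 1) - h i)) by ring, abs_neg, abs_mul, abs_pow]
    simp
  have hsgn : ∀ (i : ℕ) (t : ℝ), |(-1) ^ i * t| = |t| := by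
    intro i t
    rw [abs_mul, abs_pow]
    simp
  have hya : |y (a - 1)| = |f 0| := by
    have := hyA 0 (by omega)
    simp only [walkA, if_true, pow_zero, one_mul] at this
    rw [this]
  have hcen : |X ⟨a - 1, by omega⟩| = 4 * |f 0| := by
    simp only [hX]
    rw [if_pos (by omega), abs_mul, hya]; norm_num
  have hnon : ∀ j (hj : j < a + b - 1), j ≠ a - 1 → |X ⟨j, hj⟩| = 2 * |y j| := by
    intro j hj hne
    simp only [hX]
    rw [if_neg (by omega), abs_mul]; norm_num
  refine ⟨X, le_antisymm ?_ ?_, ?_⟩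
  · refine (pi_norm_le_iff_of_nonneg zero_le_one).2 ?_
    rintro ⟨j, hj⟩
    rw [Real.norm_eq_abs]
    by_cases h1 : j = a - 1
    · subst h1
      rw [hcen]; linarith
    · rw [hnon j hj h1]
      by_cases h2 : j < a
      · have := hf' (j + 1) (by omega)
        simp only [hy, if_pos h2, hsgn]
        linarith
      · have := hg' (j + 1 - a) (by omega)
        simp only [hy, if_neg h2, hsgn]
        linarith
  · rcases hpeak with h | ⟨i, h0, hi, h⟩ | ⟨i, h0, hi, h⟩
    · refine le_trans ?_ (norm_le_pi_norm X ⟨a - 1, by omega⟩)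
      rw [Real.norm_eq_abs, hcen, h]; norm_num
    · refine le_trans ?_ (norm_le_pi_norm X ⟨walkA a i, by unfold walkA; split_ifs <;> omega⟩)
      rw [Real.norm_eq_abs, hnon _ _ (by unfold walkA; split_ifs <;> omega), hyA i hi.le, hsgn, h]
      norm_num
    · refine le_trans ?_ (norm_le_pi_norm X ⟨walkB a b i, by unfold walkB; split_ifs <;> omega⟩)
      rw [Real.norm_eq_abs, hnon _ _ (by unfold walkB; split_ifs <;> omega), hyB i hi.le, hsgn, h]
      norm_num
  · refine (pi_norm_le_iff_of_nonneg hm).2 fun k => ?_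
    have wA : ∀ i ≤ a, walkA a i < a + b - 1 := by
      intro i hi; unfold walkA; split_ifs <;> omega
    have wB : ∀ i ≤ b, walkB a b i < a + b - 1 := by
      intro i hi; unfold walkB; split_ifs <;> omega
    rw [Real.norm_eq_abs]
    by_cases hk : (k : ℕ) < a
    · obtain ⟨i, hi, hik⟩ : ∃ i, i < a ∧ walkA a i = k := by
        by_cases h : (k : ℕ) = a - 1
        · exact ⟨0, by omega, by simp [walkA, h]⟩
        · exact ⟨k + 1, by omega, by simp [walkA]⟩
      have hk' : k = ⟨walkA a i, by omega⟩ := Fin.ext hik.symm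
      rw [hk', mulVec_first_edge ha hb X hi, hyX _ (wA _ (by omega)), hyX _ (wA _ (by omega)),
        hyA _ (by omega), hyA _ (by omega), hstep]
      exact hf i hi
    · obtain ⟨i, hi⟩ : ∃ i, (k : ℕ) = a + i := ⟨k - a, by omega⟩
      have hib : i < b := by omega
      have hk' : k = ⟨a + i, by omega⟩ := Fin.ext hi
      rw [hk', mulVec_second_edge ha hb X hib, hyX _ (wB _ (by omega)), hyX _ (wB _ (by omega)),
        hyB _ (by omega), hyB _ (by omega), hstep]
      exact hg i hib

lemma isLeast_of_bounds {a b : ℕ} {m : ℝ}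
    (hlow : ∀ X : Fin (a + b - 1) → ℝ, ‖X‖ = 1 → m ≤ ‖(ETW a b).mulVec X‖)
    (hex : ∃ X : Fin (a + b - 1) → ℝ, ‖X‖ = 1 ∧ ‖(ETW a b).mulVec X‖ ≤ m) :
    IsLeast {r : ℝ | ∃ X : Fin (a + b - 1) → ℝ, ‖X‖ = 1 ∧ r = ‖(ETW a b).mulVec X‖} m := by
  obtain ⟨X, hX, hle⟩ := hex
  refine ⟨⟨X, hX, le_antisymm (hlow X hX) hle⟩, ?_⟩
  rintro r ⟨Y, hY, rfl⟩
  exact hlow Y hY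

/-- The labelling of an odd closed walk that interpolates linearly between `c` and `-c`. -/
noncomputable def linearLabel (n : ℕ) (c : ℝ) (i : ℕ) : ℝ := c - 2 * c * i / n

lemma linearLabel_zero (n : ℕ) (c : ℝ) : linearLabel n c 0 = c := by simp [linearLabel]

lemma linearLabel_self {n : ℕ} (hn : 0 < n) (c : ℝ) : linearLabel n c n = -c := by
  have : (n : ℝ) ≠ 0 := by positivity
  rw [linearLabel]; field_simp; ring

lemma abs_linearLabel_step_le {n : ℕ} (hn : 0 < n) {c m : ℝ} (hc : 0 ≤ c) (hm : 2 * c ≤ n * m)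
    (i : ℕ) : |linearLabel n c (i + 1) - linearLabel n c i| ≤ m := by
  have hn' : (0 : ℝ) < n := by positivity
  have e : linearLabel n c (i + 1) - linearLabel n c i = -(2 * c / n) := by
    simp only [linearLabel]; push_cast; ring
  rw [e, abs_neg, abs_of_nonneg (by positivity), div_le_iff₀ hn']
  linarith

lemma abs_linearLabel_le {n : ℕ} {c : ℝ} (hc : 0 ≤ c) {i : ℕ} (hi : i < n) :
    |linearLabel n c i| ≤ c := by
  have hn' : (0 : ℝ) < n := by exact_mod_cast (by omega : 0 < n)
  have h1 : 2 * c * i / n ≤ 2 * c := by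
    rw [div_le_iff₀ hn']
    exact mul_le_mul_of_nonneg_left (by exact_mod_cast hi.le) (by positivity)
  have h2 : 0 ≤ 2 * c * i / n := by positivity
  rw [linearLabel, abs_le]
  constructor <;> linarith

/-- The labelling of slope `m` with peak value `1 / 2` at position `p`. -/
noncomputable def tentLabel (m : ℝ) (p i : ℕ) : ℝ := 1 / 2 - |(i : ℝ) - p| * m

lemma tentLabel_peak (m : ℝ) (p : ℕ) : tentLabel m p p = 1 / 2 := by simp [tentLabel]

lemma tentLabel_of_le {m : ℝ} {p i : ℕ} (h : i ≤ p) :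
    tentLabel m p i = 1 / 2 - ((p : ℝ) - i) * m := by
  have : (i : ℝ) ≤ p := by exact_mod_cast h
  rw [tentLabel, abs_of_nonpos (by linarith)]; ring

lemma tentLabel_of_ge {m : ℝ} {p i : ℕ} (h : p ≤ i) :
    tentLabel m p i = 1 / 2 - ((i : ℝ) - p) * m := by
  have : (p : ℝ) ≤ i := by exact_mod_cast h
  rw [tentLabel, abs_of_nonneg (by linarith)]

lemma abs_tentLabel_step_le {m : ℝ} (hm : 0 ≤ m) (p i : ℕ) :
    |tentLabel m p (i + 1) - tentLabel m p i| ≤ m := by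
  rcases lt_or_ge i p with h | h
  · rw [tentLabel_of_le (by omega), tentLabel_of_le h.le, abs_le]
    push_cast
    constructor <;> linarith
  · rw [tentLabel_of_ge (by omega), tentLabel_of_ge h, abs_le]
    push_cast
    constructor <;> linarith

lemma abs_tentLabel_le {m : ℝ} (hm : 0 ≤ m) {p i : ℕ} (h : |(i : ℝ) - p| * m ≤ 1) :
    |tentLabel m p i| ≤ 1 / 2 := by
  have : 0 ≤ |(i : ℝ) - p| * m := by positivity
  rw [tentLabel, abs_le]
  constructor <;> linarith

lemma abs_cast_sub_cast_le {n i p : ℕ} (hi : i ≤ n) (hp : p ≤ n) : |(i : ℝ) - p| ≤ n := by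
  have h1 : (i : ℝ) ≤ n := by exact_mod_cast hi
  have h2 : (p : ℝ) ≤ n := by exact_mod_cast hp
  have h3 : (0 : ℝ) ≤ i := by positivity
  have h4 : (0 : ℝ) ≤ p := by positivity
  rw [abs_le]
  constructor <;> linarith

lemma tentLabel_odd_zero (p : ℕ) : tentLabel (1 / ((2 * p + 1 : ℕ) : ℝ)) p 0 =
    1 / (2 * ((2 * p + 1 : ℕ) : ℝ)) := by
  rw [tentLabel_of_le (Nat.zero_le _)]
  have : ((2 * p + 1 : ℕ) : ℝ) ≠ 0 := by positivity
  push_cast at *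
  field_simp
  ring

lemma tentLabel_odd_self (p : ℕ) : tentLabel (1 / ((2 * p + 1 : ℕ) : ℝ)) p (2 * p + 1) =
    -(1 / (2 * ((2 * p + 1 : ℕ) : ℝ))) := by
  rw [tentLabel_of_ge (by omega)]
  have : ((2 * p + 1 : ℕ) : ℝ) ≠ 0 := by positivity
  push_cast at *
  field_simp
  ring

lemma abs_tentLabel_odd_le {n p i : ℕ} (hp : p ≤ n) (hi : i ≤ n) :
    |tentLabel (1 / (n : ℝ)) p i| ≤ 1 / 2 := by
  apply abs_tentLabel_le (by positivity)
  rw [mul_one_div]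
  exact div_le_one_of_le₀ (abs_cast_sub_cast_le hi hp) (by positivity)

lemma one_div_two_mul_cast_le {n : ℕ} (hn : 2 < n) : 1 / (2 * (n : ℝ)) ≤ 1 / 4 := by
  have : (2 : ℝ) < n := by exact_mod_cast hn
  exact one_div_le_one_div_of_le (by norm_num) (by linarith)

lemma two_mul_one_div_le {n k : ℕ} (hn : 2 < n) (hk : 2 < k) :
    2 * (1 / (2 * (n : ℝ))) ≤ k * (1 / (n : ℝ)) := by
  have h1 : (1 : ℝ) ≤ k := by exact_mod_cast (by omega : 1 ≤ k)
  have h2 : 2 * (1 / (2 * (n : ℝ))) = 1 * (1 / (n : ℝ)) := by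
    have : (n : ℝ) ≠ 0 := by positivity
    field_simp
  rw [h2]
  exact mul_le_mul_of_nonneg_right h1 (by positivity)

/-- For integers `a, b > 2` with `a` odd, the smallest normalized signless ∞-Laplacian
eigenvalue `μ_∞ = min_{‖X‖_∞ = 1} ‖WX‖_∞` of `ET(n, a, b)` (with `W` its weighted
signless incidence matrix) equals: `1/a` if `b` is odd and `a > 2b`;
`1/(2 min{a, b})` if `b` is odd, `a ≤ 2b` and `b ≤ 2a`; `1/b` if `b` is odd and
`b > 2a`; and `1/max{2a, a+b}` if `b` is even. -/
theorem stmt17 (a b : ℕ) (ha : 2 < a) (hb : 2 < b) (haodd : Odd a) :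
    (Odd b → 2 * b < a →
      IsLeast {r : ℝ | ∃ X : Fin (a + b - 1) → ℝ, ‖X‖ = 1 ∧ r = ‖(ETW a b).mulVec X‖}
        (1 / (a : ℝ))) ∧
    (Odd b → a ≤ 2 * b → b ≤ 2 * a →
      IsLeast {r : ℝ | ∃ X : Fin (a + b - 1) → ℝ, ‖X‖ = 1 ∧ r = ‖(ETW a b).mulVec X‖}
        (1 / ((2 * min a b : ℕ) : ℝ))) ∧
    (Odd b → 2 * a < b →
      IsLeast {r : ℝ | ∃ X : Fin (a + b - 1) → ℝ, ‖X‖ = 1 ∧ r = ‖(ETW a b).mulVec X‖}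
        (1 / (b : ℝ))) ∧
    (Even b →
      IsLeast {r : ℝ | ∃ X : Fin (a + b - 1) → ℝ, ‖X‖ = 1 ∧ r = ‖(ETW a b).mulVec X‖}
        (1 / ((max (2 * a) (a + b) : ℕ) : ℝ))) := by
  have haR : (2 : ℝ) < a := by exact_mod_cast ha
  have hbR : (2 : ℝ) < b := by exact_mod_cast hb
  refine ⟨fun hbodd hab => ?_, fun hbodd hab hba => ?_, fun hbodd hab => ?_, fun hbeven => ?_⟩
  · have habR : 2 * (b : ℝ) < a := by exact_mod_cast hab
    apply isLeast_of_bounds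
    · intro X hX
      obtain ⟨c, hc0, hc4, h1, h2, h3⟩ := constraints_of_norm_eq_one ha hb haodd hX rfl
      have h2 := h2 hbodd
      have hm := norm_nonneg ((ETW a b).mulVec X)
      rw [div_le_iff₀' (by linarith)]
      rcases h3 with h | h | ⟨-, h⟩
      · nlinarith
      · exact h
      · have := h hbodd
        nlinarith
    · obtain ⟨p, rfl⟩ := haodd
      refine exists_norm_eq_one_of_labels (f := tentLabel (1 / ((2 * p + 1 : ℕ) : ℝ)) p)
        (g := linearLabel b (1 / (2 * ((2 * p + 1 : ℕ) : ℝ)))) ha hb ⟨p, rfl⟩ ?_ ?_ ?_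
        (fun i _ => abs_tentLabel_step_le (by positivity) _ _)
        (fun i _ => abs_linearLabel_step_le (by omega) (by positivity)
          (two_mul_one_div_le ha hb) i)
        (fun i hi => abs_tentLabel_odd_le (by omega) hi.le) ?_ ?_
        (Or.inr (Or.inl ⟨p, by omega, by omega, ?_⟩))
      · rw [tentLabel_odd_zero, tentLabel_odd_self]
      · rw [tentLabel_odd_zero, linearLabel_zero]
      · rw [tentLabel_odd_zero, linearLabel_self (by omega), hbodd.neg_one_pow]; ring
      · intro i hi
        linarith [abs_linearLabel_le (n := b) (c := 1 / (2 * ((2 * p + 1 : ℕ) : ℝ)))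
          (by positivity) hi, one_div_two_mul_cast_le ha]
      · rw [tentLabel_odd_zero, abs_of_nonneg (by positivity)]
        exact one_div_two_mul_cast_le ha
      · rw [tentLabel_peak]; norm_num
  · have habR : (a : ℝ) ≤ 2 * b := by exact_mod_cast hab
    have hbaR : (b : ℝ) ≤ 2 * a := by exact_mod_cast hba
    have hM : (((2 * min a b : ℕ)) : ℝ) = 2 * min (a : ℝ) b := by push_cast; ring
    have hmin : (2 : ℝ) < min (a : ℝ) b := lt_min haR hbR
    rw [hM]
    apply isLeast_of_bounds
    · intro X hX
      obtain ⟨c, hc0, hc4, h1, h2, h3⟩ := constraints_of_norm_eq_one ha hb haodd hX rfl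
      have h2 := h2 hbodd
      have hm := norm_nonneg ((ETW a b).mulVec X)
      rw [div_le_iff₀' (by linarith)]
      rcases h3 with h | h | ⟨-, h⟩
      · rcases min_cases (a : ℝ) b with ⟨e, _⟩ | ⟨e, _⟩ <;> rw [e] <;> nlinarith
      · rcases min_cases (a : ℝ) b with ⟨e, _⟩ | ⟨e, _⟩ <;> rw [e] <;> nlinarith
      · have := h hbodd
        rcases min_cases (a : ℝ) b with ⟨e, _⟩ | ⟨e, _⟩ <;> rw [e] <;> nlinarith
    · have key : ∀ k : ℝ, min (a : ℝ) b ≤ k → 2 * (1 / 4 : ℝ) ≤ k * (1 / (2 * min (a : ℝ) b)) := by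
        intro k hk
        rw [mul_one_div k, le_div_iff₀ (by linarith)]
        linarith
      refine exists_norm_eq_one_of_labels (f := linearLabel a (1 / 4))
        (g := linearLabel b (1 / 4)) ha hb haodd ?_ ?_ ?_
        (fun i _ => abs_linearLabel_step_le (by omega) (by norm_num) (key _ (min_le_left _ _)) i)
        (fun i _ => abs_linearLabel_step_le (by omega) (by norm_num) (key _ (min_le_right _ _)) i)
        (fun i hi => (abs_linearLabel_le (by norm_num) hi).trans (by norm_num))
        (fun i hi => (abs_linearLabel_le (by norm_num) hi).trans (by norm_num)) ?_ (Or.inl ?_)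
      · rw [linearLabel_zero, linearLabel_self (by omega)]
      · rw [linearLabel_zero, linearLabel_zero]
      · rw [linearLabel_zero, linearLabel_self (by omega), hbodd.neg_one_pow]; ring
      · rw [linearLabel_zero]; norm_num
      · rw [linearLabel_zero]; norm_num
  · have habR : 2 * (a : ℝ) < b := by exact_mod_cast hab
    apply isLeast_of_bounds
    · intro X hX
      obtain ⟨c, hc0, hc4, h1, h2, h3⟩ := constraints_of_norm_eq_one ha hb haodd hX rfl
      have h2 := h2 hbodd
      have hm := norm_nonneg ((ETW a b).mulVec X)
      rw [div_le_iff₀' (by linarith)]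
      rcases h3 with h | h | ⟨-, h⟩
      · nlinarith
      · nlinarith
      · exact h hbodd
    · obtain ⟨p, rfl⟩ := hbodd
      refine exists_norm_eq_one_of_labels (g := tentLabel (1 / ((2 * p + 1 : ℕ) : ℝ)) p)
        (f := linearLabel a (1 / (2 * ((2 * p + 1 : ℕ) : ℝ)))) ha hb haodd ?_ ?_ ?_
        (fun i _ => abs_linearLabel_step_le (by omega) (by positivity)
          (two_mul_one_div_le hb ha) i)
        (fun i _ => abs_tentLabel_step_le (by positivity) _ _) ?_
        (fun i hi => abs_tentLabel_odd_le (by omega) hi.le) ?_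
        (Or.inr (Or.inr ⟨p, by omega, by omega, ?_⟩))
      · rw [linearLabel_zero, linearLabel_self (by omega)]
      · rw [tentLabel_odd_zero, linearLabel_zero]
      · rw [tentLabel_odd_self, linearLabel_zero, Odd.neg_one_pow ⟨p, rfl⟩]; ring
      · intro i hi
        linarith [abs_linearLabel_le (n := a) (c := 1 / (2 * ((2 * p + 1 : ℕ) : ℝ)))
          (by positivity) hi, one_div_two_mul_cast_le hb]
      · rw [linearLabel_zero, abs_of_nonneg (by positivity)]
        exact one_div_two_mul_cast_le hb
      · rw [tentLabel_peak]; norm_num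
  · have hM : ((max (2 * a) (a + b) : ℕ) : ℝ) = max (2 * (a : ℝ)) (a + b) := by push_cast; rfl
    rw [hM]
    have hpos : 0 < max (2 * (a : ℝ)) (a + b) := lt_max_of_lt_left (by linarith)
    apply isLeast_of_bounds
    · intro X hX
      obtain ⟨c, hc0, hc4, h1, -, h3⟩ := constraints_of_norm_eq_one ha hb haodd hX rfl
      have hm := norm_nonneg ((ETW a b).mulVec X)
      have hl := mul_le_mul_of_nonneg_right (le_max_left (2 * (a : ℝ)) (a + b)) hm
      have hr := mul_le_mul_of_nonneg_right (le_max_right (2 * (a : ℝ)) (a + b)) hm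
      rw [div_le_iff₀' hpos]
      rcases h3 with h | h | ⟨h, -⟩
      · linarith
      · nlinarith
      · linarith
    · rcases le_total b a with hle | hle
      · have hleR : (b : ℝ) ≤ a := by exact_mod_cast hle
        rw [max_eq_left (by linarith)]
        refine exists_norm_eq_one_of_labels (f := linearLabel a (1 / 4))
          (g := fun _ => 1 / 4) ha hb haodd ?_ ?_ ?_
          (fun i _ => abs_linearLabel_step_le (by omega) (by norm_num) ?_ i)
          (fun i _ => ?_)
          (fun i hi => (abs_linearLabel_le (by norm_num) hi).trans (by norm_num))
          (fun i hi => by norm_num) ?_ (Or.inl ?_)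
        · rw [linearLabel_zero, linearLabel_self (by omega)]
        · rw [linearLabel_zero]
        · rw [linearLabel_zero, hbeven.neg_one_pow]; ring
        · rw [mul_one_div (a : ℝ), le_div_iff₀ (by linarith)]; linarith
        · rw [sub_self, abs_zero]; positivity
        · rw [linearLabel_zero]; norm_num
        · rw [linearLabel_zero]; norm_num
      · have hleR : (a : ℝ) ≤ b := by exact_mod_cast hle
        rw [max_eq_right (by linarith)]
        obtain ⟨p, rfl⟩ := hbeven
        have hab : (0 : ℝ) < a + ((p + p : ℕ) : ℝ) := by linarith
        set c : ℝ := a / (2 * (a + ((p + p : ℕ) : ℝ))) with hc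
        have hc0 : 0 ≤ c := by positivity
        have hc4 : c ≤ 1 / 4 := by
          rw [hc, div_le_iff₀ (by linarith)]; linarith
        have ht : ∀ i, tentLabel (1 / (a + ((p + p : ℕ) : ℝ))) p i =
            c + (p - |(i : ℝ) - p|) * (1 / (a + ((p + p : ℕ) : ℝ))) := by
          intro i
          rw [tentLabel, hc]
          have := hab.ne'
          push_cast at *
          field_simp
          ring
        have ht0 : tentLabel (1 / (a + ((p + p : ℕ) : ℝ))) p 0 = c := by
          rw [ht]; simp
        have htb : tentLabel (1 / (a + ((p + p : ℕ) : ℝ))) p (p + p) = c := by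
          rw [ht]; simp
        refine exists_norm_eq_one_of_labels (f := linearLabel a c)
          (g := tentLabel (1 / (a + ((p + p : ℕ) : ℝ))) p) ha hb haodd ?_ ?_ ?_
          (fun i _ => abs_linearLabel_step_le (by omega) hc0 ?_ i)
          (fun i _ => abs_tentLabel_step_le (by positivity) _ _)
          (fun i hi => (abs_linearLabel_le hc0 hi).trans (by linarith))
          (fun i hi => abs_tentLabel_le (by positivity) ?_) ?_
          (Or.inr (Or.inr ⟨p, by omega, by omega, ?_⟩))
        · rw [linearLabel_zero, linearLabel_self (by omega)]
        · rw [linearLabel_zero, ht0]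
        · rw [linearLabel_zero, htb, Even.neg_one_pow ⟨p, rfl⟩]; ring
        · rw [hc]
          apply le_of_eq
          field_simp
        · rw [mul_one_div]
          refine div_le_one_of_le₀ ?_ hab.le
          linarith [abs_cast_sub_cast_le (n := p + p) (p := p) hi.le (by omega)]
        · rw [linearLabel_zero, abs_of_nonneg hc0]; exact hc4
        · rw [tentLabel_peak]; norm_num
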